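/- Let 1 ≤ q < ∞, −1/q ≤ λ < 0, 1 < q_j < ∞ with 1/q = 1/q_1 + ⋯ + 1/q_m, γ = γ_1 + ⋯ + γ_m, α ∈ ℝ with α ≠ −Q, and −1/q_j < λ_j < 0 with qλ = q_jλ_j for j = 1,…,m. Set A_m = ∫_{(ℝ^{2n+1})^m} ∏_{j=1}^m |y_j|_h^{Qλ_j − γ_j/q + α(λ_j + 1/q_j)} / [max(1, |y_1|_h^Q, …, |y_m|_h^Q)]^m dy_1⋯dy_m and assume A_m < ∞. Then the least constant C such that ‖P^h_m(f_1,…,f_m)‖_{L^{q,λ}(ℍⁿ,|x|_h^α,|x|_h^γ)} ≤ C·∏_{j=1}^m ‖f_j‖_{L^{q_j,λ_j}(ℍⁿ,|x|_h^α,|x|_h^{q_jγ_j/q})} holds for all nonnegative radial f_j ∈ L^{q_j,λ_j}(ℍⁿ,|x|_h^α,|x|_h^{q_jγ_j/q}) is exactly A_m; in particular equality is attained for f_j(x) = |x|_h^{Qλ_j − γ_j/q + α(λ_j + 1/q_j)}. -/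

import Mathlib

open MeasureTheory Real ENNReal Finset

noncomputable section

/-- Korányi norm on ℝ^{2n+1}. -/
def knorm (n : ℕ) (x : Fin (2*n+1) → ℝ) : ℝ :=
  ((∑ i : Fin (2*n), x (Fin.castSucc i) ^ 2) ^ 2 + x (Fin.last (2*n)) ^ 2) ^ ((1:ℝ)/4)

/-- homogeneous dimension Q = 2n+2, as a real number -/
def Qr (n : ℕ) : ℝ := 2 * n + 2

/-- volume of the unit Korányi ball -/
def OmegaQ (n : ℕ) : ℝ :=
  2 * Real.pi ^ ((n : ℝ) + 1/2) * Real.Gamma ((n : ℝ)/2) /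
    ((n + 1) * Real.Gamma (n : ℝ) * Real.Gamma (((n : ℝ) + 1)/2))

def omegaQ (n : ℕ) : ℝ := Qr n * OmegaQ n

/-- Heisenberg group law on ℝ^{2n+1}. -/
def hmul (n : ℕ) (x y : Fin (2*n+1) → ℝ) : Fin (2*n+1) → ℝ := fun i =>
  if (i : ℕ) < 2*n then x i + y i
  else x i + y i + 2 * ∑ j : Fin n,
      (y ⟨j, by have := j.isLt; omega⟩ * x ⟨n + j, by have := j.isLt; omega⟩
        - x ⟨j, by have := j.isLt; omega⟩ * y ⟨n + j, by have := j.isLt; omega⟩)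

/-- Heisenberg dilation δ_r. -/
def hdil (n : ℕ) (r : ℝ) (x : Fin (2*n+1) → ℝ) : Fin (2*n+1) → ℝ :=
  fun i => if (i : ℕ) < 2*n then r * x i else r^2 * x i

/-- left-invariant distance d(p,q) = |q⁻¹ ∘ p|_h -/
def hdist (n : ℕ) (p q : Fin (2*n+1) → ℝ) : ℝ := knorm n (hmul n (fun i => - q i) p)

/-- Korányi ball B(a,R) -/
def hball (n : ℕ) (a : Fin (2*n+1) → ℝ) (R : ℝ) : Set (Fin (2*n+1) → ℝ) :=
  {y | hdist n a y < R}

/-- two power weighted Morrey norm on the Heisenberg group -/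
def morreyNorm (n : ℕ) (q lam al ga : ℝ) (f : (Fin (2*n+1) → ℝ) → ℝ) : ℝ≥0∞ :=
  ⨆ (a : Fin (2*n+1) → ℝ) (R : ℝ) (_ : 0 < R),
    (∫⁻ x in hball n a R, ENNReal.ofReal (knorm n x ^ al)) ^ (-(lam + 1/q)) *
    (∫⁻ x in hball n a R, ENNReal.ofReal (|f x| ^ q * knorm n x ^ ga)) ^ (1/q)

/-- m-linear Hardy–Littlewood–Pólya operator -/
def hlpOp (n m : ℕ) (f : Fin m → (Fin (2*n+1) → ℝ) → ℝ) (x : Fin (2*n+1) → ℝ) : ℝ :=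
  ∫ y : Fin m → Fin (2*n+1) → ℝ,
    (∏ j, f j (y j)) /
      (Finset.univ.fold max (knorm n x ^ Qr n) (fun j => knorm n (y j) ^ Qr n)) ^ m

/-- m-linear Hilbert operator -/
def hilbOp (n m : ℕ) (f : Fin m → (Fin (2*n+1) → ℝ) → ℝ) (x : Fin (2*n+1) → ℝ) : ℝ :=
  ∫ y : Fin m → Fin (2*n+1) → ℝ,
    (∏ j, f j (y j)) / (knorm n x ^ Qr n + ∑ j, knorm n (y j) ^ Qr n) ^ m

/-- the constant A_m -/
def Aconst (n m : ℕ) (e : Fin m → ℝ) : ℝ≥0∞ :=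
  ∫⁻ y : Fin m → Fin (2*n+1) → ℝ,
    ENNReal.ofReal ((∏ j, knorm n (y j) ^ e j) /
      (Finset.univ.fold max (1:ℝ) (fun j => knorm n (y j) ^ Qr n)) ^ m)

/-- the constant B_m -/
def Bconst (n m : ℕ) (e : Fin m → ℝ) : ℝ≥0∞ :=
  ∫⁻ y : Fin m → Fin (2*n+1) → ℝ,
    ENNReal.ofReal ((∏ j, knorm n (y j) ^ e j) /
      (1 + ∑ j, knorm n (y j) ^ Qr n) ^ m)




lemma Qr_pos (n : ℕ) : 0 < Qr n := by unfold Qr; positivity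

lemma knorm_nonneg (n : ℕ) (x : Fin (2*n+1) → ℝ) : 0 ≤ knorm n x := by
  unfold knorm; positivity

lemma knorm_cont (n : ℕ) : Continuous (knorm n) := by
  unfold knorm
  refine Continuous.rpow_const ?_ (fun _ => Or.inr (by norm_num))
  fun_prop

lemma knorm_meas (n : ℕ) : Measurable (knorm n) := (knorm_cont n).measurable

lemma knorm_pow4 (n : ℕ) (x : Fin (2*n+1) → ℝ) : knorm n x ^ 4 =
    ((∑ i : Fin (2*n), x (Fin.castSucc i) ^ 2) ^ 2 + x (Fin.last (2*n)) ^ 2) := by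
  unfold knorm
  rw [← Real.rpow_natCast, ← Real.rpow_mul (by positivity)]
  norm_num

lemma knorm_dil (n : ℕ) {r : ℝ} (hr : 0 ≤ r) (x : Fin (2*n+1) → ℝ) :
    knorm n (hdil n r x) = r * knorm n x := by
  have h : (knorm n (hdil n r x)) ^ 4 = (r * knorm n x) ^ 4 := by
    rw [mul_pow, knorm_pow4, knorm_pow4]
    simp only [hdil, Fin.val_castSucc, Fin.is_lt, if_true, Fin.val_last, lt_irrefl, if_false,
      mul_pow, ← Finset.mul_sum]
    ring
  exact (pow_left_inj₀ (knorm_nonneg _ _) (mul_nonneg hr (knorm_nonneg _ _)) (by norm_num)).1 h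

lemma abs_le_knorm (n : ℕ) (x : Fin (2*n+1) → ℝ) (i : Fin (2*n)) :
    |x (Fin.castSucc i)| ≤ knorm n x := by
  have h4 := knorm_pow4 n x
  have h1 : x (Fin.castSucc i) ^ 2 ≤ ∑ i : Fin (2*n), x (Fin.castSucc i) ^ 2 :=
    Finset.single_le_sum (f := fun i : Fin (2*n) => x (Fin.castSucc i) ^ 2)
      (fun _ _ => sq_nonneg _) (Finset.mem_univ i)
  have h2 : |x (Fin.castSucc i)| ^ 4 ≤ knorm n x ^ 4 := by
    rw [h4]
    have : |x (Fin.castSucc i)| ^ 4 = (x (Fin.castSucc i) ^ 2) ^ 2 := by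
      rw [← sq_abs (x _)]; ring
    rw [this]
    have h5 : (0:ℝ) ≤ x (Fin.castSucc i) ^ 2 := sq_nonneg _
    nlinarith [sq_nonneg (x (Fin.last (2*n)))]
  exact le_of_pow_le_pow_left₀ (by norm_num) (knorm_nonneg _ _) h2

lemma abs_last_le_knorm (n : ℕ) (x : Fin (2*n+1) → ℝ) :
    |x (Fin.last (2*n))| ≤ knorm n x ^ 2 := by
  have h4 := knorm_pow4 n x
  refine abs_le_of_sq_le_sq ?_ (by positivity)
  nlinarith [sq_nonneg (∑ i : Fin (2*n), x (Fin.castSucc i) ^ 2)]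

lemma knorm_eq_zero (n : ℕ) {x : Fin (2*n+1) → ℝ} (h : knorm n x = 0) : x = 0 := by
  funext i
  refine Fin.lastCases ?_ (fun i => ?_) i
  · have := abs_last_le_knorm n x
    rw [h] at this
    simpa using this
  · have := abs_le_knorm n x i
    rw [h] at this
    simpa using this

lemma knorm_zero (n : ℕ) : knorm n 0 = 0 := by
  have := knorm_pow4 n 0
  simpa using this

lemma ae_knorm_pos (n : ℕ) : ∀ᵐ x : Fin (2*n+1) → ℝ, 0 < knorm n x := by
  have : ∀ᵐ x : Fin (2*n+1) → ℝ, x ≠ 0 := by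
    simp [ae_iff]
  filter_upwards [this] with x hx
  exact lt_of_le_of_ne (knorm_nonneg _ _) (fun h => hx (knorm_eq_zero n h.symm))

lemma volume_knorm_le (n : ℕ) (r : ℝ) : volume {x : Fin (2*n+1) → ℝ | knorm n x ≤ r} < ⊤ := by
  rcases lt_or_ge r 0 with hr | hr
  · have : {x : Fin (2*n+1) → ℝ | knorm n x ≤ r} = ∅ := by
      ext x; simp only [Set.mem_ofPred_eq, Set.mem_empty_iff_false, iff_false, not_le]
      exact hr.trans_le (knorm_nonneg _ _)
    simp [this]
  refine lt_of_le_of_lt (measure_mono (t := Metric.closedBall 0 (r + r^2)) ?_)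
    (isCompact_closedBall _ _).measure_lt_top
  intro x hx
  simp only [Set.mem_ofPred_eq] at hx
  rw [mem_closedBall_zero_iff, pi_norm_le_iff_of_nonneg (by positivity)]
  intro i
  have h0 := knorm_nonneg n x
  refine Fin.lastCases ?_ (fun i => ?_) i
  · have := abs_last_le_knorm n x
    rw [Real.norm_eq_abs]; nlinarith
  · have := abs_le_knorm n x i
    rw [Real.norm_eq_abs]; nlinarith [sq_nonneg r]

/-! dilations -/

lemma hdil_hdil (n : ℕ) {r s : ℝ} (x : Fin (2*n+1) → ℝ) :
    hdil n r (hdil n s x) = hdil n (r * s) x := by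
  funext i; unfold hdil; split_ifs <;> ring

lemma hdil_one (n : ℕ) (x : Fin (2*n+1) → ℝ) : hdil n 1 x = x := by
  funext i; unfold hdil; split_ifs <;> ring

lemma hdil_meas (n : ℕ) (r : ℝ) : Measurable (hdil n r) := by
  unfold hdil
  refine measurable_pi_lambda _ (fun i => ?_)
  split_ifs <;> fun_prop

/-- dilation as a measurable equivalence -/
def dilEquiv (n : ℕ) (r : ℝ) (hr : 0 < r) : (Fin (2*n+1) → ℝ) ≃ᵐ (Fin (2*n+1) → ℝ) where
  toFun := hdil n r
  invFun := hdil n r⁻¹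
  left_inv x := by rw [hdil_hdil, inv_mul_cancel₀ hr.ne', hdil_one]
  right_inv x := by rw [hdil_hdil, mul_inv_cancel₀ hr.ne', hdil_one]
  measurable_toFun := hdil_meas n r
  measurable_invFun := hdil_meas n _

lemma hdil_emb (n : ℕ) {r : ℝ} (hr : 0 < r) : MeasurableEmbedding (hdil n r) :=
  (dilEquiv n r hr).measurableEmbedding

lemma map_hdil (n : ℕ) {r : ℝ} (hr : 0 < r) :
    Measure.map (hdil n r) volume = ENNReal.ofReal (r ^ (-Qr n)) • volume := by
  classical
  set D : Fin (2*n+1) → ℝ := fun i => if (i : ℕ) < 2*n then r else r^2 with hD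
  have hdet : (Matrix.diagonal D).det = r ^ (Qr n) := by
    rw [Matrix.det_diagonal, Fin.prod_univ_castSucc]
    simp only [hD, Fin.val_castSucc, Fin.is_lt, if_true, Fin.val_last, lt_irrefl, if_false,
      Finset.prod_const, Finset.card_univ, Fintype.card_fin, Qr]
    rw [← pow_add, ← Real.rpow_natCast]; push_cast; rfl
  have hpos : 0 < r ^ Qr n := Real.rpow_pos_of_pos hr _
  have hmap : (⇑(Matrix.toLin' (Matrix.diagonal D))) = hdil n r := by
    funext x i
    simp only [Matrix.toLin'_apply, Matrix.mulVec_diagonal, hD, hdil]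
    split_ifs <;> rfl
  have h := Real.smul_map_diagonal_volume_pi (D := D) (by rw [hdet]; exact hpos.ne')
  rw [hdet, hmap, abs_of_pos hpos] at h
  have h2 : ENNReal.ofReal (r ^ (-Qr n)) • (ENNReal.ofReal (r ^ Qr n) • Measure.map (hdil n r) volume)
      = ENNReal.ofReal (r ^ (-Qr n)) • volume := by rw [h]
  rw [smul_smul, ← ENNReal.ofReal_mul (by positivity), ← Real.rpow_add hr] at h2
  simpa using h2

lemma lintegral_hdil (n : ℕ) {r : ℝ} (hr : 0 < r) (G : (Fin (2*n+1) → ℝ) → ℝ≥0∞) :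
    ∫⁻ x, G (hdil n r x) = ENNReal.ofReal (r ^ (-Qr n)) * ∫⁻ x, G x := by
  rw [← (hdil_emb n hr).lintegral_map, map_hdil n hr, lintegral_smul_measure, smul_eq_mul]

lemma setLintegral_hdil (n : ℕ) {r : ℝ} (hr : 0 < r) (G : (Fin (2*n+1) → ℝ) → ℝ≥0∞)
    (S : Set (Fin (2*n+1) → ℝ)) :
    ∫⁻ x in (hdil n r ⁻¹' S), G (hdil n r x) = ENNReal.ofReal (r ^ (-Qr n)) * ∫⁻ x in S, G x := by
  rw [← (hdil_emb n hr).lintegral_map, ← (hdil_emb n hr).restrict_map, map_hdil n hr,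
    Measure.restrict_smul, lintegral_smul_measure, smul_eq_mul]

lemma qmp_hdil (n : ℕ) {r : ℝ} (hr : 0 < r) :
    Measure.QuasiMeasurePreserving (hdil n r) volume volume := by
  refine ⟨hdil_meas n r, ?_⟩
  rw [map_hdil n hr]
  exact Measure.smul_absolutelyContinuous

lemma lintegral_pi_hdil (n m : ℕ) {r : ℝ} (hr : 0 < r)
    (G : (Fin m → Fin (2*n+1) → ℝ) → ℝ≥0∞) :
    ∫⁻ y : Fin m → Fin (2*n+1) → ℝ, G (fun j => hdil n r (y j)) = ENNReal.ofReal (r ^ (-Qr n)) ^ m * ∫⁻ y, G y := by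
  have hemb : MeasurableEmbedding (fun (y : Fin m → Fin (2*n+1) → ℝ) j => hdil n r (y j)) :=
    (MeasurableEquiv.piCongrRight (fun _ : Fin m => dilEquiv n r hr)).measurableEmbedding
  have hmap : Measure.map (fun (y : Fin m → Fin (2*n+1) → ℝ) j => hdil n r (y j)) volume
      = ENNReal.ofReal (r ^ (-Qr n)) ^ m • volume := by
    symm
    have hv : (volume : Measure (Fin m → Fin (2*n+1) → ℝ)) = Measure.pi (fun _ => volume) := rfl
    have hsf : SigmaFinite (Measure.map (hdil n r) (volume : Measure (Fin (2*n+1) → ℝ))) :=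
      (dilEquiv n r hr).sigmaFinite_map
    have h1 := Measure.pi_map_pi (μ := fun _ : Fin m => (volume : Measure (Fin (2*n+1) → ℝ)))
      (f := fun _ => hdil n r) (fun _ => (hdil_meas n r).aemeasurable)
    rw [hv, h1]
    symm
    refine Measure.pi_eq (fun s hs => ?_)
    rw [Measure.smul_apply, Measure.pi_pi, map_hdil n hr]
    simp [Finset.prod_mul_distrib]
  rw [← hemb.lintegral_map, hmap, lintegral_smul_measure, smul_eq_mul]

/-! group law and balls -/

lemma hmul_hdil (n : ℕ) (r : ℝ) (x y : Fin (2*n+1) → ℝ) :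
    hmul n (hdil n r x) (hdil n r y) = hdil n r (hmul n x y) := by
  funext i
  by_cases hi : (i : ℕ) < 2*n
  · simp only [hmul, hdil, hi, if_true]; ring
  · have h1 : ∀ j : Fin n, (j : ℕ) < 2 * n := fun j => by have := j.isLt; omega
    have h2 : ∀ j : Fin n, n + (j : ℕ) < 2 * n := fun j => by have := j.isLt; omega
    simp only [hmul, hdil, hi, if_false, h1, h2, if_true]
    rw [mul_add, mul_add, mul_left_comm, Finset.mul_sum (a := r ^ 2)]
    congr 2
    exact Finset.sum_congr rfl (fun j _ => by ring)

lemma hdist_hdil (n : ℕ) {r : ℝ} (hr : 0 ≤ r) (x y : Fin (2*n+1) → ℝ) :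
    hdist n (hdil n r x) (hdil n r y) = r * hdist n x y := by
  unfold hdist
  have : (fun i => -hdil n r y i) = hdil n r (fun i => - y i) := by
    funext i; unfold hdil; split_ifs <;> ring
  rw [this, hmul_hdil, knorm_dil n hr]

lemma hball_preimage (n : ℕ) {r : ℝ} (hr : 0 < r) (a : Fin (2*n+1) → ℝ) (R : ℝ) :
    hdil n r ⁻¹' (hball n (hdil n r a) (r * R)) = hball n a R := by
  ext y
  simp only [hball, Set.mem_preimage, Set.mem_ofPred_eq, hdist_hdil n hr.le]
  exact mul_lt_mul_iff_right₀ hr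

lemma hball_open (n : ℕ) (a : Fin (2*n+1) → ℝ) (R : ℝ) : IsOpen (hball n a R) := by
  refine isOpen_lt ?_ continuous_const
  unfold hdist
  refine (knorm_cont n).comp ?_
  refine continuous_pi (fun i => ?_)
  unfold hmul
  split_ifs <;> fun_prop

lemma hball_self (n : ℕ) (a : Fin (2*n+1) → ℝ) {R : ℝ} (hR : 0 < R) : a ∈ hball n a R := by
  have : hmul n (fun i => - a i) a = 0 := by
    funext i
    unfold hmul
    split_ifs
    · simp
    · simp
  simp only [hball, hdist, Set.mem_ofPred_eq, this, knorm_zero]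
  exact hR

lemma hball_pos (n : ℕ) (a : Fin (2*n+1) → ℝ) {R : ℝ} (hR : 0 < R) :
    0 < volume (hball n a R) :=
  (hball_open n a R).measure_pos _ ⟨a, hball_self n a hR⟩

/-! weights -/

/-- extended nonnegative power weight -/
def wt (n : ℕ) (s : ℝ) (x : Fin (2*n+1) → ℝ) : ℝ≥0∞ := ENNReal.ofReal (knorm n x ^ s)

lemma wt_meas (n : ℕ) (s : ℝ) : Measurable (wt n s) :=
  ((knorm_meas n).pow_const s).ennreal_ofReal

lemma wt_ne_top (n : ℕ) (s : ℝ) (x : Fin (2*n+1) → ℝ) : wt n s x ≠ ⊤ := ENNReal.ofReal_ne_top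

lemma wt_pos (n : ℕ) (s : ℝ) {x : Fin (2*n+1) → ℝ} (hx : 0 < knorm n x) : 0 < wt n s x :=
  ENNReal.ofReal_pos.2 (Real.rpow_pos_of_pos hx _)

lemma wt_mul (n : ℕ) (s t : ℝ) {x : Fin (2*n+1) → ℝ} (hx : 0 < knorm n x) :
    wt n s x * wt n t x = wt n (s + t) x := by
  unfold wt
  rw [← ENNReal.ofReal_mul (Real.rpow_nonneg hx.le _), Real.rpow_add hx]

lemma wt_rpow (n : ℕ) (s p : ℝ) {x : Fin (2*n+1) → ℝ} (hx : 0 < knorm n x) :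
    wt n s x ^ p = wt n (s * p) x := by
  unfold wt
  rw [ENNReal.ofReal_rpow_of_pos (Real.rpow_pos_of_pos hx _), ← Real.rpow_mul hx.le]

lemma wt_prod (n : ℕ) {ι : Type*} (S : Finset ι) (s : ι → ℝ) {x : Fin (2*n+1) → ℝ}
    (hx : 0 < knorm n x) : ∏ i ∈ S, wt n (s i) x = wt n (∑ i ∈ S, s i) x := by
  classical
  induction S using Finset.induction with
  | empty => simp [wt]
  | insert i S hi ih => rw [Finset.prod_insert hi, Finset.sum_insert hi, ih, wt_mul n _ _ hx]

lemma wt_dil (n : ℕ) (s : ℝ) {r : ℝ} (hr : 0 ≤ r) (x : Fin (2*n+1) → ℝ) :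
    wt n s (hdil n r x) = ENNReal.ofReal (r ^ s) * wt n s x := by
  unfold wt
  rw [knorm_dil n hr, Real.mul_rpow hr (knorm_nonneg _ _), ENNReal.ofReal_mul (by positivity)]

lemma setLIntegral_wt_pos (n : ℕ) (s : ℝ) {S : Set (Fin (2*n+1) → ℝ)} (hS : 0 < volume S) :
    0 < ∫⁻ x in S, wt n s x := by
  rw [setLIntegral_pos_iff (wt_meas n s)]
  refine hS.trans_le ?_
  rw [← measure_inter_add_sdiff₀ S (t := {x | 0 < knorm n x})
    (measurableSet_lt measurable_const (knorm_meas n)).nullMeasurableSet]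
  have h0 : volume (S \ {x | 0 < knorm n x}) = 0 :=
    measure_mono_null (fun x hx => hx.2) (ae_iff.1 (ae_knorm_pos n))
  rw [h0, add_zero]
  refine measure_mono (fun x hx => ⟨?_, hx.1⟩)
  exact (wt_pos n s hx.2).ne'


/-- sublevel region used to cut the integrals -/
def Ereg (n : ℕ) (β T : ℝ) : Set (Fin (2*n+1) → ℝ) := {x | 0 < knorm n x ∧ knorm n x ^ β < T}

lemma Ereg_meas (n : ℕ) (β T : ℝ) : MeasurableSet (Ereg n β T) :=
  (measurableSet_lt measurable_const (knorm_meas n)).inter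
    (measurableSet_lt ((knorm_meas n).pow_const β) measurable_const)

lemma rpow_bdd {y p : ℝ} (h1 : 1/2 ≤ y) (h2 : y ≤ 1) : y ^ p ≤ 2 ^ |p| := by
  have hy : 0 < y := by linarith
  rcases le_total 0 p with hp | hp
  · calc y ^ p ≤ 1 := Real.rpow_le_one hy.le h2 hp
      _ ≤ 2 ^ |p| := Real.one_le_rpow (by norm_num) (abs_nonneg _)
  · rw [abs_of_nonpos hp]
    have h3 : y ^ p = (y⁻¹) ^ (-p) := by rw [Real.inv_rpow hy.le, Real.rpow_neg hy.le, inv_inv]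
    rw [h3]
    refine Real.rpow_le_rpow (by positivity) ?_ (by linarith)
    rw [inv_le_comm₀ hy (by norm_num)]; linarith

/-- dyadic shell -/
def Sh (n : ℕ) (β : ℝ) (k : ℕ) : Set (Fin (2*n+1) → ℝ) :=
  {x | 0 < knorm n x ∧ (1/2:ℝ) ^ (k+1) ≤ knorm n x ^ β ∧ knorm n x ^ β < (1/2:ℝ) ^ k}

lemma Sh_zero_lt (n : ℕ) {β : ℝ} (hβ : β ≠ 0) (s : ℝ) : ∫⁻ x in Sh n β 0, wt n s x < ⊤ := by
  have hmem : ∀ x ∈ Sh n β 0, ∀ p, knorm n x ^ p ≤ 2 ^ |p / β| := by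
    intro x hx p
    have h : knorm n x ^ p = (knorm n x ^ β) ^ (p / β) := by
      rw [← Real.rpow_mul hx.1.le]; congr 1; field_simp
    rw [h]
    exact rpow_bdd (by simpa using hx.2.1) (by simpa using hx.2.2.le)
  have hvol : volume (Sh n β 0) < ⊤ := by
    refine lt_of_le_of_lt (measure_mono (fun x hx => ?_)) (volume_knorm_le n (2 ^ |1 / β|))
    have := hmem x hx 1
    simpa using this
  have : ∫⁻ x in Sh n β 0, wt n s x ≤ ∫⁻ x in Sh n β 0, ENNReal.ofReal (2 ^ |s / β|) := by
    refine setLIntegral_mono measurable_const (fun x hx => ?_)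
    exact ENNReal.ofReal_le_ofReal (hmem x hx s)
  refine this.trans_lt ?_
  rw [setLIntegral_const]
  exact ENNReal.mul_lt_top ENNReal.ofReal_lt_top hvol

lemma Sh_scale (n : ℕ) {β : ℝ} (hβ : β ≠ 0) (κ : ℝ) (k : ℕ) :
    ∫⁻ x in Sh n β k, wt n (κ * β - Qr n) x
      = ENNReal.ofReal ((1/2:ℝ) ^ κ) ^ k * ∫⁻ x in Sh n β 0, wt n (κ * β - Qr n) x := by
  set r : ℝ := (1/2:ℝ) ^ ((k:ℝ) / β) with hr
  have hr0 : 0 < r := by positivity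
  have hrβ : r ^ β = (1/2:ℝ) ^ k := by
    rw [hr, ← Real.rpow_mul (by norm_num), div_mul_cancel₀ _ hβ, Real.rpow_natCast]
  have hpre : hdil n r ⁻¹' (Sh n β k) = Sh n β 0 := by
    ext x
    have hk : (0:ℝ) < (1/2)^k := by positivity
    simp only [Sh, Set.mem_preimage, Set.mem_ofPred_eq, knorm_dil n hr0.le,
      Real.mul_rpow hr0.le (knorm_nonneg n x), hrβ, pow_succ, pow_zero, one_mul]
    rw [mul_pos_iff_of_pos_left hr0, mul_le_mul_iff_right₀ hk]
    constructor
    · rintro ⟨h1, h2, h3⟩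
      exact ⟨h1, h2, by nlinarith⟩
    · rintro ⟨h1, h2, h3⟩
      exact ⟨h1, h2, by nlinarith⟩
  have h := setLintegral_hdil n hr0 (wt n (κ * β - Qr n)) (Sh n β k)
  rw [hpre] at h
  simp only [wt_dil n _ hr0.le] at h
  rw [lintegral_const_mul' _ _ ENNReal.ofReal_ne_top] at h
  have h2 : ENNReal.ofReal (r ^ (Qr n)) * (ENNReal.ofReal (r ^ (-Qr n)) * ∫⁻ x in Sh n β k, wt n (κ * β - Qr n) x)
     = ∫⁻ x in Sh n β k, wt n (κ * β - Qr n) x := by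
    rw [← mul_assoc, ← ENNReal.ofReal_mul (by positivity), ← Real.rpow_add hr0]
    simp
  rw [← h2, ← h, ← mul_assoc, ← ENNReal.ofReal_mul (by positivity), ← Real.rpow_add hr0,
    ← ENNReal.ofReal_pow (by positivity)]
  congr 2
  rw [show Qr n + (κ * β - Qr n) = β * κ by ring, Real.rpow_mul hr0.le, hrβ,
    ← Real.rpow_natCast, ← Real.rpow_mul (by norm_num), ← Real.rpow_natCast, ← Real.rpow_mul (by norm_num), mul_comm]

lemma Ereg_one_lt (n : ℕ) {β : ℝ} (hβ : β ≠ 0) {κ : ℝ} (hκ : 0 < κ) :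
    ∫⁻ x in Ereg n β 1, wt n (κ * β - Qr n) x < ⊤ := by
  have hsub : Ereg n β 1 ⊆ ⋃ k, Sh n β k := by
    intro x hx
    obtain ⟨k, hk1, hk2⟩ := exists_nat_pow_near_of_lt_one (x := knorm n x ^ β) (y := 1/2)
      (Real.rpow_pos_of_pos hx.1 _) hx.2.le (by norm_num) (by norm_num)
    rcases hk2.lt_or_eq with h | h
    · exact Set.mem_iUnion.2 ⟨k, hx.1, hk1.le, h⟩
    · rcases k with _ | k
      · exfalso; have := hx.2; simp at h; linarith
      · refine Set.mem_iUnion.2 ⟨k, hx.1, h.ge, ?_⟩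
        rw [h]
        exact pow_lt_pow_right_of_lt_one₀ (by norm_num) (by norm_num) (by omega)
  refine (lintegral_mono_set hsub).trans_lt ((lintegral_iUnion_le _ _).trans_lt ?_)
  rw [tsum_congr (fun k => Sh_scale n hβ κ k)]
  rw [ENNReal.tsum_mul_right]
  refine ENNReal.mul_lt_top ?_ (Sh_zero_lt n hβ _)
  rw [ENNReal.tsum_geometric]
  refine ENNReal.inv_lt_top.2 (tsub_pos_of_lt ?_)
  rw [ENNReal.ofReal_lt_one]
  exact Real.rpow_lt_one (by norm_num) (by norm_num) hκ

lemma Ereg_scale (n : ℕ) {β : ℝ} (hβ : β ≠ 0) (κ : ℝ) {T : ℝ} (hT : 0 < T) :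
    ∫⁻ x in Ereg n β T, wt n (κ * β - Qr n) x
      = ENNReal.ofReal (T ^ κ) * ∫⁻ x in Ereg n β 1, wt n (κ * β - Qr n) x := by
  set r : ℝ := T ^ (1 / β) with hr
  have hr0 : 0 < r := by positivity
  have hrβ : r ^ β = T := by
    rw [hr, ← Real.rpow_mul hT.le, div_mul_cancel₀ _ hβ, Real.rpow_one]
  have hpre : hdil n r ⁻¹' (Ereg n β T) = Ereg n β 1 := by
    ext x
    simp only [Ereg, Set.mem_preimage, Set.mem_ofPred_eq, knorm_dil n hr0.le,
      Real.mul_rpow hr0.le (knorm_nonneg n x), hrβ]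
    rw [mul_pos_iff_of_pos_left hr0]
    constructor
    · rintro ⟨h1, h3⟩
      exact ⟨h1, by nlinarith⟩
    · rintro ⟨h1, h3⟩
      exact ⟨h1, by nlinarith⟩
  have h := setLintegral_hdil n hr0 (wt n (κ * β - Qr n)) (Ereg n β T)
  rw [hpre] at h
  simp only [wt_dil n _ hr0.le] at h
  rw [lintegral_const_mul' _ _ ENNReal.ofReal_ne_top] at h
  have h2 : ENNReal.ofReal (r ^ (Qr n)) * (ENNReal.ofReal (r ^ (-Qr n)) * ∫⁻ x in Ereg n β T, wt n (κ * β - Qr n) x)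
     = ∫⁻ x in Ereg n β T, wt n (κ * β - Qr n) x := by
    rw [← mul_assoc, ← ENNReal.ofReal_mul (by positivity), ← Real.rpow_add hr0]
    simp
  rw [← h2, ← h, ← mul_assoc, ← ENNReal.ofReal_mul (by positivity), ← Real.rpow_add hr0]
  congr 2
  rw [show Qr n + (κ * β - Qr n) = β * κ by ring, Real.rpow_mul hr0.le, hrβ]

lemma key_bound (n : ℕ) {al κ : ℝ} (hal : al ≠ -Qr n) (hκ0 : 0 < κ) (hκ1 : κ ≤ 1) :
    ∃ C : ℝ≥0∞, C < ⊤ ∧ ∀ S : Set (Fin (2*n+1) → ℝ), 0 < volume S →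
      (∫⁻ x in S, wt n al x) ^ (-κ) * ∫⁻ x in S, wt n (κ * (Qr n + al) - Qr n) x ≤ C := by
  have hβ : Qr n + al ≠ 0 := fun h => hal (by linarith)
  set β := Qr n + al with hβd
  refine ⟨(∫⁻ x in Ereg n β 1, wt n (κ * β - Qr n) x) + 1,
    ENNReal.add_lt_top.2 ⟨Ereg_one_lt n hβ hκ0, ENNReal.one_lt_top⟩, fun S hS => ?_⟩
  set W := ∫⁻ x in S, wt n al x with hW
  have hWpos : 0 < W := setLIntegral_wt_pos n al hS
  rcases eq_or_ne W ⊤ with hWt | hWt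
  · rw [hWt, ENNReal.top_rpow_of_neg (by linarith), zero_mul]; exact zero_le
  set T := W.toReal with hT
  have hT0 : 0 < T := ENNReal.toReal_pos hWpos.ne' hWt
  have hTW : ENNReal.ofReal T = W := ENNReal.ofReal_toReal hWt
  have hI : ∫⁻ x in S, wt n (κ * β - Qr n) x ≤
      (∫⁻ x in Ereg n β T, wt n (κ * β - Qr n) x) + ENNReal.ofReal (T ^ (κ - 1)) * W := by
    rw [hW, ← lintegral_const_mul' _ _ ENNReal.ofReal_ne_top, ← lintegral_indicator (Ereg_meas n β T)]
    calc ∫⁻ x in S, wt n (κ * β - Qr n) x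
        ≤ ∫⁻ x in S, ((Ereg n β T).indicator (wt n (κ * β - Qr n)) x
            + ENNReal.ofReal (T ^ (κ - 1)) * wt n al x) := by
          refine lintegral_mono_ae (ae_restrict_of_ae ?_)
          filter_upwards [ae_knorm_pos n] with x hx
          by_cases hxE : x ∈ Ereg n β T
          · rw [Set.indicator_of_mem hxE]; exact le_self_add
          · refine le_add_left ?_
            have hge : T ≤ knorm n x ^ β := by
              by_contra hcon
              exact hxE ⟨hx, not_le.1 hcon⟩
            unfold wt
            rw [← ENNReal.ofReal_mul (by positivity)]
            refine ENNReal.ofReal_le_ofReal ?_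
            have h1 : knorm n x ^ (κ * β - Qr n) = (knorm n x ^ β) ^ (κ - 1) * knorm n x ^ al := by
              rw [← Real.rpow_mul hx.le, ← Real.rpow_add hx]; congr 1; rw [hβd]; ring
            rw [h1]
            refine mul_le_mul_of_nonneg_right ?_ (by positivity)
            exact Real.rpow_le_rpow_of_nonpos hT0 hge (by linarith)
      _ = (∫⁻ x in S, (Ereg n β T).indicator (wt n (κ * β - Qr n)) x)
            + ∫⁻ x in S, ENNReal.ofReal (T ^ (κ - 1)) * wt n al x :=
          lintegral_add_right _ (measurable_const.mul (wt_meas n al))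
      _ ≤ _ := by gcongr; exact Measure.restrict_le_self
  rw [Ereg_scale n hβ κ hT0] at hI
  have hTk : ENNReal.ofReal (T ^ κ) = W ^ κ := by
    rw [← ENNReal.ofReal_rpow_of_pos hT0, hTW]
  have hTk1 : ENNReal.ofReal (T ^ (κ-1)) * W = W ^ κ := by
    rw [← ENNReal.ofReal_rpow_of_pos hT0, hTW]
    nth_rewrite 2 [← ENNReal.rpow_one W]
    rw [← ENNReal.rpow_add _ _ hWpos.ne' hWt]; simp
  rw [hTk, hTk1] at hI
  calc W ^ (-κ) * ∫⁻ x in S, wt n (κ * β - Qr n) x ≤ W ^ (-κ) * (W ^ κ * (∫⁻ x in Ereg n β 1, wt n (κ * β - Qr n) x) + W ^ κ) := by gcongr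
    _ = (W ^ (-κ) * W ^ κ) * ((∫⁻ x in Ereg n β 1, wt n (κ * β - Qr n) x) + 1) := by ring
    _ = _ := by
      rw [← ENNReal.rpow_add _ _ hWpos.ne' hWt]; simp

lemma exists_good_ball (n : ℕ) (hn : 1 ≤ n) {al : ℝ} (hal : al ≠ -Qr n) :
    ∃ a : Fin (2*n+1) → ℝ, ∫⁻ x in hball n a 1, wt n al x < ⊤ := by
  have hβ : Qr n + al ≠ 0 := fun h => hal (by linarith)
  have hfin := Ereg_one_lt n hβ one_pos
  rw [one_mul, add_sub_cancel_left] at hfin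
  have hneg : ∀ y : Fin (2*n+1) → ℝ, hmul n (fun i => - y i) 0 = fun i => - y i := by
    intro y; funext i; unfold hmul; split_ifs <;> simp
  have hkneg : ∀ y : Fin (2*n+1) → ℝ, knorm n (fun i => - y i) = knorm n y := by
    intro y; unfold knorm; simp
  suffices h : ∃ a : Fin (2*n+1) → ℝ, ∀ x ∈ hball n a 1, 0 < knorm n x → knorm n x ^ (Qr n + al) < 1 by
    obtain ⟨a, ha⟩ := h
    refine ⟨a, lt_of_le_of_lt ?_ hfin⟩
    refine lintegral_mono' (Measure.restrict_mono_ae ?_) le_rfl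
    filter_upwards [ae_knorm_pos n] with x hx hxa
    exact ⟨hx, ha x hxa hx⟩
  rcases lt_or_gt_of_ne hβ with hneg' | hpos
  · set i0 : Fin (2*n) := ⟨0, by omega⟩
    refine ⟨fun i => if i = Fin.castSucc i0 then 10 else 0, fun x hx hx0 => ?_⟩
    refine Real.rpow_lt_one_of_one_lt_of_neg ?_ hneg'
    have h1 := abs_le_knorm n x i0
    have hx' : hdist n _ x < 1 := hx
    have h2 := (abs_le_knorm n _ i0).trans_lt hx'
    have h3 : (Fin.castSucc i0 : ℕ) < 2 * n := i0.isLt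
    simp only [hmul, h3, if_true] at h2
    rw [abs_lt] at h2
    have h4 := le_abs_self (x (Fin.castSucc i0))
    linarith
  · refine ⟨0, fun x hx hx0 => ?_⟩
    have hx' : knorm n (hmul n (fun i => - x i) 0) < 1 := hx
    rw [hneg, hkneg] at hx'
    exact Real.rpow_lt_one hx0.le hx' hpos


/-- Morrey supremum of the extremal power -/
def Msup (n : ℕ) (al κ : ℝ) : ℝ≥0∞ :=
  ⨆ (a : Fin (2*n+1) → ℝ) (R : ℝ) (_ : 0 < R),
    (∫⁻ x in hball n a R, wt n al x) ^ (-κ) *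
    ∫⁻ x in hball n a R, wt n (κ * (Qr n + al) - Qr n) x

lemma Msup_lt_top (n : ℕ) {al κ : ℝ} (hal : al ≠ -Qr n) (hκ0 : 0 < κ) (hκ1 : κ ≤ 1) :
    Msup n al κ < ⊤ := by
  obtain ⟨C, hC, h⟩ := key_bound n hal hκ0 hκ1
  refine lt_of_le_of_lt ?_ hC
  exact iSup_le fun a => iSup_le fun R => iSup_le fun hR => h _ (hball_pos n a hR)

lemma Msup_pos (n : ℕ) (hn : 1 ≤ n) {al κ : ℝ} (hal : al ≠ -Qr n) (hκ0 : 0 < κ) :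
    0 < Msup n al κ := by
  obtain ⟨a, ha⟩ := exists_good_ball n hn hal
  refine lt_of_lt_of_le ?_ (le_iSup_of_le a (le_iSup_of_le 1 (le_iSup_of_le one_pos le_rfl)))
  refine ENNReal.mul_pos ?_ (setLIntegral_wt_pos n _ (hball_pos n a one_pos)).ne'
  rw [ENNReal.rpow_neg]
  refine ENNReal.inv_ne_zero.2 (ENNReal.rpow_ne_top_of_nonneg hκ0.le ha.ne)

lemma morrey_eq (n : ℕ) {p mu al g κ : ℝ} {c : ℝ≥0∞} {f : (Fin (2*n+1) → ℝ) → ℝ} (hp : 0 < p)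
    (hmu : mu + 1/p = κ/p) (hc : c ≠ ⊤)
    (hf : ∀ᵐ x, ENNReal.ofReal (|f x| ^ p * knorm n x ^ g) = c ^ p * wt n (κ * (Qr n + al) - Qr n) x) :
    morreyNorm n p mu al g f = c * Msup n al κ ^ (1/p) := by
  have hp' : 0 < 1/p := by positivity
  have h1 : Msup n al κ ^ (1/p) = ENNReal.orderIsoRpow (1/p) hp' (Msup n al κ) := rfl
  rw [h1]
  unfold Msup morreyNorm
  simp only [OrderIso.map_iSup, ENNReal.mul_iSup]
  refine iSup_congr fun a => iSup_congr fun R => iSup_congr fun hR => ?_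
  rw [lintegral_congr_ae (ae_restrict_of_ae hf),
    lintegral_const_mul' _ _ (ENNReal.rpow_ne_top_of_nonneg hp.le hc), hmu]
  simp only [ENNReal.orderIsoRpow_apply]
  rw [ENNReal.mul_rpow_of_nonneg _ _ hp'.le, ENNReal.mul_rpow_of_nonneg _ _ hp'.le,
    ← ENNReal.rpow_mul, ← ENNReal.rpow_mul, mul_one_div_cancel hp.ne', ENNReal.rpow_one,
    show -(κ/p) = -κ * (1/p) by ring]
  simp only [wt]
  ring

/-- weighted Minkowski inequality -/
lemma mink {X Y : Type*} [MeasurableSpace X] [MeasurableSpace Y] (μ : Measure X) (ν : Measure Y)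
    [SFinite μ] [SFinite ν] {q : ℝ} (hq : 1 ≤ q) (F : Y → X → ℝ≥0∞)
    (hF : AEMeasurable (Function.uncurry F) (ν.prod μ)) (c : Y → ℝ≥0∞) (hc : Measurable c)
    (hc0 : ∀ᵐ y ∂ν, c y ≠ 0) (hct : ∀ y, c y ≠ ⊤) (D : ℝ≥0∞)
    (hb : ∀ᵐ y ∂ν, ∫⁻ x, F y x ^ q ∂μ ≤ (c y * D) ^ q) :
    ∫⁻ x, (∫⁻ y, F y x ∂ν) ^ q ∂μ ≤ ((∫⁻ y, c y ∂ν) * D) ^ q := by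
  have hq0 : 0 < q := by linarith
  have hFsw : AEMeasurable (Function.uncurry fun x y => F y x) (μ.prod ν) := hF.prod_swap
  have hmeas : ∀ᵐ x ∂μ, AEMeasurable (fun y => F y x) ν := by
    have h := hFsw.aestronglyMeasurable.prodMk_left
    filter_upwards [h] with x hx
    exact hx.aemeasurable
  have h1 : ∀ᵐ x ∂μ, (∫⁻ y, F y x ∂ν) ^ q ≤
      (∫⁻ y, F y x ^ q * c y ^ (1 - q) ∂ν) * (∫⁻ y, c y ∂ν) ^ (q - 1) := by
    filter_upwards [hmeas] with x hx
    have h2 : ∫⁻ y, F y x ∂ν = ∫⁻ y, (F y x ^ q * c y ^ (1 - q)) ^ (1/q) * c y ^ (1 - 1/q) ∂ν := by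
      refine lintegral_congr_ae ?_
      filter_upwards [hc0] with y hy
      rw [ENNReal.mul_rpow_of_nonneg _ _ (by positivity), ← ENNReal.rpow_mul, ← ENNReal.rpow_mul,
        mul_one_div_cancel hq0.ne', ENNReal.rpow_one, mul_assoc,
        ← ENNReal.rpow_add _ _ hy (hct y)]
      have : (1 - q) * (1/q) + (1 - 1/q) = 0 := by field_simp; ring
      rw [this, ENNReal.rpow_zero, mul_one]
    have h3 : ∫⁻ y, F y x ∂ν ≤ (∫⁻ y, F y x ^ q * c y ^ (1 - q) ∂ν) ^ (1/q) * (∫⁻ y, c y ∂ν) ^ (1 - 1/q) := by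
      rw [h2]
      refine ENNReal.lintegral_mul_norm_pow_le ?_ hc.aemeasurable (by positivity) ?_ (by ring)
      · exact (hx.pow_const q).mul (hc.pow_const _).aemeasurable
      · rw [sub_nonneg, div_le_one hq0]; exact hq
    refine (ENNReal.rpow_le_rpow h3 hq0.le).trans (le_of_eq ?_)
    rw [ENNReal.mul_rpow_of_nonneg _ _ hq0.le, ← ENNReal.rpow_mul, ← ENNReal.rpow_mul,
      one_div_mul_cancel hq0.ne', ENNReal.rpow_one]
    congr 2
    field_simp
  have hGm : AEMeasurable (Function.uncurry fun x y => F y x ^ q * c y ^ (1 - q)) (μ.prod ν) := by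
    refine (hFsw.pow_const q).mul ?_
    exact ((hc.pow_const (1-q)).comp measurable_snd).aemeasurable
  calc ∫⁻ x, (∫⁻ y, F y x ∂ν) ^ q ∂μ
      ≤ ∫⁻ x, (∫⁻ y, F y x ^ q * c y ^ (1 - q) ∂ν) * (∫⁻ y, c y ∂ν) ^ (q - 1) ∂μ :=
        lintegral_mono_ae h1
    _ = (∫⁻ x, (∫⁻ y, F y x ^ q * c y ^ (1 - q) ∂ν) ∂μ) * (∫⁻ y, c y ∂ν) ^ (q - 1) := by
        refine lintegral_mul_const'' _ ?_
        exact hGm.lintegral_prod_right'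
    _ = (∫⁻ y, (∫⁻ x, F y x ^ q * c y ^ (1 - q) ∂μ) ∂ν) * (∫⁻ y, c y ∂ν) ^ (q - 1) := by
        rw [lintegral_lintegral_swap hGm]
    _ ≤ (∫⁻ y, c y * D ^ q ∂ν) * (∫⁻ y, c y ∂ν) ^ (q - 1) := by
        refine mul_le_mul_left ?_ _
        refine lintegral_mono_ae ?_
        filter_upwards [hb, hc0] with y hy hy0
        have hne : c y ^ (1 - q) ≠ ⊤ := by
          rw [show 1 - q = -(q - 1) by ring, ENNReal.rpow_neg]
          refine ENNReal.inv_ne_top.2 ?_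
          exact (ENNReal.rpow_pos (pos_iff_ne_zero.2 hy0) (hct y)).ne'
        rw [lintegral_mul_const' _ _ hne]
        refine (mul_le_mul_left hy _).trans (le_of_eq ?_)
        rw [ENNReal.mul_rpow_of_nonneg _ _ hq0.le, mul_right_comm,
          ← ENNReal.rpow_add _ _ hy0 (hct y)]
        simp
    _ = ((∫⁻ y, c y ∂ν) * D) ^ q := by
        rw [lintegral_mul_const _ hc, ENNReal.mul_rpow_of_nonneg _ _ hq0.le, mul_right_comm]
        congr 1
        nth_rewrite 1 [← ENNReal.rpow_one (∫⁻ y, c y ∂ν)]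
        rw [← ENNReal.rpow_add_of_nonneg _ _ (by norm_num) (by linarith)]
        congr 1; ring

/-! the kernel -/

/-- the maximum in the denominator -/
def Kmax (n m : ℕ) (b : ℝ) (y : Fin m → Fin (2*n+1) → ℝ) : ℝ :=
  Finset.univ.fold max b (fun j => knorm n (y j) ^ Qr n)

lemma Kmax_pos (n m : ℕ) {b : ℝ} (hb : 0 < b) (y : Fin m → Fin (2*n+1) → ℝ) :
    0 < Kmax n m b y :=
  hb.trans_le ((Finset.le_fold_max b).2 (Or.inl le_rfl))

lemma Kmax_meas (n m : ℕ) (b : ℝ) : Measurable (Kmax n m b) := by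
  classical
  have : ∀ s : Finset (Fin m), Measurable (fun y : Fin m → Fin (2*n+1) → ℝ =>
      s.fold max b (fun j => knorm n (y j) ^ Qr n)) := by
    intro s
    induction s using Finset.induction with
    | empty => simp
    | insert i s hi ih =>
      simp only [Finset.fold_insert hi]
      exact (((knorm_meas n).comp (measurable_pi_apply i)).pow_const _).max ih
  exact this _

lemma Kmax_dil (n m : ℕ) {r : ℝ} (hr : 0 ≤ r) (y : Fin m → Fin (2*n+1) → ℝ) :
    Kmax n m (r ^ Qr n) (fun j => hdil n r (y j)) = r ^ Qr n * Kmax n m 1 y := by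
  unfold Kmax
  have h := Finset.fold_hom (op := max) (op' := max) (s := (Finset.univ : Finset (Fin m))) (b := (1:ℝ))
    (f := fun j => knorm n (y j) ^ Qr n) (m := fun t => r ^ Qr n * t)
    (fun a b => mul_max_of_nonneg _ _ (by positivity))
  rw [← h, mul_one]
  congr 1
  funext j
  rw [knorm_dil n hr, Real.mul_rpow hr (knorm_nonneg _ _)]

/-- kernel as an extended nonnegative number -/
def Ker (n m : ℕ) (b : ℝ) (y : Fin m → Fin (2*n+1) → ℝ) : ℝ≥0∞ :=
  ENNReal.ofReal ((Kmax n m b y ^ m)⁻¹)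

lemma Ker_meas (n m : ℕ) (b : ℝ) : Measurable (Ker n m b) :=
  ((Kmax_meas n m b).pow_const m).inv.ennreal_ofReal

lemma lint_scale (n m : ℕ) (G : Fin m → (Fin (2*n+1) → ℝ) → ℝ≥0∞) {r : ℝ} (hr : 0 < r) :
    ∫⁻ y : Fin m → Fin (2*n+1) → ℝ, (∏ j, G j (y j)) * Ker n m (r ^ Qr n) y
      = ∫⁻ y : Fin m → Fin (2*n+1) → ℝ, (∏ j, G j (hdil n r (y j))) * Ker n m 1 y := by
  have h := lintegral_pi_hdil n m hr (fun y => (∏ j, G j (y j)) * Ker n m (r ^ Qr n) y)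
  have hk : ∀ y : Fin m → Fin (2*n+1) → ℝ, Ker n m (r ^ Qr n) (fun j => hdil n r (y j))
      = ENNReal.ofReal (r ^ (-Qr n)) ^ m * Ker n m 1 y := by
    intro y
    unfold Ker
    rw [Kmax_dil n m hr.le, ← ENNReal.ofReal_pow (by positivity), ← ENNReal.ofReal_mul (by positivity),
      Real.rpow_neg hr.le, mul_pow, mul_inv, inv_pow]
  simp only [hk] at h
  have hne0 : ENNReal.ofReal (r ^ (-Qr n)) ^ m ≠ 0 :=
    pow_ne_zero _ (ENNReal.ofReal_pos.2 (by positivity)).ne'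
  have hnet : ENNReal.ofReal (r ^ (-Qr n)) ^ m ≠ ⊤ := ENNReal.pow_ne_top ENNReal.ofReal_ne_top
  simp only [mul_left_comm _ (ENNReal.ofReal (r ^ (-Qr n)) ^ m)] at h
  rw [lintegral_const_mul' _ _ hnet] at h
  exact ((ENNReal.mul_right_inj hne0 hnet).1 h).symm

lemma ofReal_integrand (n m : ℕ) {b : ℝ} (_hb : 0 < b) (f : Fin m → (Fin (2*n+1) → ℝ) → ℝ)
    (hf : ∀ j x, 0 ≤ f j x) (y : Fin m → Fin (2*n+1) → ℝ) :
    ENNReal.ofReal ((∏ j, f j (y j)) / (Kmax n m b y) ^ m)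
      = (∏ j, ENNReal.ofReal (f j (y j))) * Ker n m b y := by
  rw [div_eq_mul_inv, ENNReal.ofReal_mul (Finset.prod_nonneg fun j _ => hf j _),
    ENNReal.ofReal_prod_of_nonneg (fun j _ => hf j _)]
  rfl

lemma Aconst_eq (n m : ℕ) (e : Fin m → ℝ) :
    Aconst n m e = ∫⁻ y : Fin m → Fin (2*n+1) → ℝ, (∏ j, wt n (e j) (y j)) * Ker n m 1 y := by
  unfold Aconst
  refine lintegral_congr fun y => ?_
  exact ofReal_integrand n m one_pos (fun j x => knorm n x ^ e j)
    (fun j x => Real.rpow_nonneg (knorm_nonneg _ _) _) y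

lemma hlpOp_le (n m : ℕ) (f : Fin m → (Fin (2*n+1) → ℝ) → ℝ) (hf : ∀ j x, 0 ≤ f j x)
    {x : Fin (2*n+1) → ℝ} (hx : 0 < knorm n x) :
    ENNReal.ofReal |hlpOp n m f x| ≤
      ∫⁻ y : Fin m → Fin (2*n+1) → ℝ, (∏ j, ENNReal.ofReal (f j (hdil n (knorm n x) (y j)))) * Ker n m 1 y := by
  have hb : 0 < knorm n x ^ Qr n := Real.rpow_pos_of_pos hx _
  rw [← lint_scale n m (fun j z => ENNReal.ofReal (f j z)) hx]
  rw [← Real.norm_eq_abs, ofReal_norm]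
  refine (enorm_integral_le_lintegral_enorm _).trans (le_of_eq (lintegral_congr fun y => ?_))
  rw [Real.enorm_eq_ofReal]
  · exact ofReal_integrand n m hb f hf y
  · exact div_nonneg (Finset.prod_nonneg fun j _ => hf j _) (pow_nonneg (Kmax_pos n m hb y).le _)

lemma hlpOp_pow (n m : ℕ) (e : Fin m → ℝ) (hA : Aconst n m e < ⊤)
    {x : Fin (2*n+1) → ℝ} (hx : 0 < knorm n x) :
    ENNReal.ofReal |hlpOp n m (fun j z => knorm n z ^ e j) x| = Aconst n m e * wt n (∑ j, e j) x := by
  have hb : 0 < knorm n x ^ Qr n := Real.rpow_pos_of_pos hx _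
  have hnn : ∀ (j : Fin m) (z : Fin (2*n+1) → ℝ), 0 ≤ knorm n z ^ e j :=
    fun j z => Real.rpow_nonneg (knorm_nonneg _ _) _
  have hval : ∫⁻ y : Fin m → Fin (2*n+1) → ℝ, ENNReal.ofReal ((∏ j, knorm n (y j) ^ e j) /
      (Kmax n m (knorm n x ^ Qr n) y) ^ m) = Aconst n m e * wt n (∑ j, e j) x := by
    rw [lintegral_congr (fun y => ofReal_integrand n m hb (fun j z => knorm n z ^ e j) hnn y)]
    rw [lint_scale n m (fun j z => ENNReal.ofReal (knorm n z ^ e j)) hx, Aconst_eq,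
      ← lintegral_mul_const' _ _ (wt_ne_top _ _ _)]
    refine lintegral_congr fun y => ?_
    have : ∀ j, ENNReal.ofReal (knorm n (hdil n (knorm n x) (y j)) ^ e j) =
        wt n (e j) x * wt n (e j) (y j) := fun j => wt_dil n (e j) hx.le (y j)
    simp only [this, Finset.prod_mul_distrib, wt_prod n _ _ hx]
    ring
  have hint0 : ∀ y : Fin m → Fin (2*n+1) → ℝ, 0 ≤ (∏ j, knorm n (y j) ^ e j) /
      (Kmax n m (knorm n x ^ Qr n) y) ^ m := fun y =>
    div_nonneg (Finset.prod_nonneg fun j _ => hnn j _) (pow_nonneg (Kmax_pos n m hb y).le _)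
  have hmeas : Measurable fun y : Fin m → Fin (2*n+1) → ℝ => (∏ j, knorm n (y j) ^ e j) /
      (Kmax n m (knorm n x ^ Qr n) y) ^ m := by
    refine Measurable.div ?_ ((Kmax_meas n m _).pow_const m)
    exact Finset.measurable_fun_prod _ (fun j _ => ((knorm_meas n).comp (measurable_pi_apply j)).pow_const _)
  have hop : hlpOp n m (fun j z => knorm n z ^ e j) x = (Aconst n m e * wt n (∑ j, e j) x).toReal := by
    rw [← hval]
    exact integral_eq_lintegral_of_nonneg_ae (Filter.Eventually.of_forall hint0) hmeas.aestronglyMeasurable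
  rw [hop, abs_of_nonneg ENNReal.toReal_nonneg, ENNReal.ofReal_toReal]
  exact (ENNReal.mul_lt_top hA (wt_ne_top _ _ _).lt_top).ne


lemma aemeas_of_prod {E : Type*} [MeasureSpace E] [SigmaFinite (volume : Measure E)] (k : ℕ)
    (f : Fin (k+1) → E → ℝ)
    (hf : AEMeasurable (fun y : Fin (k+1) → E => ∏ j, f j (y j)))
    (hnz : ¬ ∀ᵐ y : Fin (k+1) → E, ∏ j, f j (y j) = 0) (i : Fin (k+1)) :
    AEMeasurable (f i) := by
  have mp := volume_preserving_piFinSuccAbove (fun _ : Fin (k+1) => E) i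
  have h1 := hf.comp_quasiMeasurePreserving mp.symm.quasiMeasurePreserving
  have heq : ∀ y : Fin (k+1) → E, ∏ j, f j (y j) =
      f i (MeasurableEquiv.piFinSuccAbove (fun _ : Fin (k+1) => E) i y).1 *
        ∏ j, f (i.succAbove j) ((MeasurableEquiv.piFinSuccAbove (fun _ : Fin (k+1) => E) i y).2 j) := by
    intro y
    rw [Fin.prod_univ_succAbove _ i]
    rfl
  have h2 : AEMeasurable (fun p : E × (Fin k → E) => f i p.1 * ∏ j, f (i.succAbove j) (p.2 j))
      ((volume : Measure E).prod volume) := by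
    refine h1.congr (Filter.Eventually.of_forall fun p => ?_)
    simp only [Function.comp]
    rw [heq]
    simp only [MeasurableEquiv.apply_symm_apply]
  have h3 := h2.aestronglyMeasurable.prodMk_right
  by_contra hcon
  apply hnz
  have h4 : ∀ᵐ z : Fin k → E, ∏ j, f (i.succAbove j) (z j) = 0 := by
    filter_upwards [h3] with z hz
    by_contra hne
    apply hcon
    have h5 := hz.aemeasurable.mul_const (∏ j, f (i.succAbove j) (z j))⁻¹
    refine h5.congr (Filter.Eventually.of_forall fun x => ?_)
    simp only
    rw [mul_inv_cancel_right₀ hne]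
  have h6 : ∀ᵐ p : E × (Fin k → E), ∏ j, f (i.succAbove j) (p.2 j) = 0 :=
    Measure.quasiMeasurePreserving_snd.ae h4
  have h7 := mp.quasiMeasurePreserving.ae h6
  filter_upwards [h7] with y hy
  rw [heq, hy, mul_zero]

lemma hdil_joint_meas (n : ℕ) : Measurable (fun p : ℝ × (Fin (2*n+1) → ℝ) => hdil n p.1 p.2) := by
  unfold hdil
  refine measurable_pi_lambda _ (fun i => ?_)
  split_ifs <;> fun_prop

lemma ae_all_pos (n m : ℕ) : ∀ᵐ y : Fin m → Fin (2*n+1) → ℝ, ∀ j, 0 < knorm n (y j) := by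
  rw [ae_all_iff]
  intro j
  exact (Measure.quasiMeasurePreserving_eval (fun _ : Fin m => (volume : Measure (Fin (2*n+1) → ℝ))) j).ae
    (ae_knorm_pos n)

lemma qmp_joint (n m : ℕ) (B : Set (Fin (2*n+1) → ℝ)) (j : Fin m) :
    Measure.QuasiMeasurePreserving
      (fun p : (Fin m → Fin (2*n+1) → ℝ) × (Fin (2*n+1) → ℝ) => hdil n (knorm n (p.1 j)) p.2)
      ((volume : Measure (Fin m → Fin (2*n+1) → ℝ)).prod (volume.restrict B)) volume := by
  have hm : Measurable (fun p : (Fin m → Fin (2*n+1) → ℝ) × (Fin (2*n+1) → ℝ) =>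
      hdil n (knorm n (p.1 j)) p.2) := by
    refine (hdil_joint_meas n).comp (Measurable.prodMk ?_ measurable_snd)
    exact (knorm_meas n).comp ((measurable_pi_apply j).comp measurable_fst)
  refine ⟨hm, Measure.AbsolutelyContinuous.mk fun s hs hs0 => ?_⟩
  rw [Measure.map_apply hm hs, Measure.measure_prod_null (hm hs)]
  filter_upwards [ae_all_pos n m] with y hy
  have h := (qmp_hdil n (hy j)).preimage_null hs0
  exact le_antisymm ((Measure.restrict_le_self _).trans h.le) (zero_le)

lemma prod_rpow_const {ι : Type*} (S : Finset ι) (W : ℝ≥0∞) (s : ι → ℝ) (hs : ∀ i ∈ S, 0 ≤ s i) :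
    ∏ i ∈ S, W ^ s i = W ^ (∑ i ∈ S, s i) := by
  classical
  induction S using Finset.induction with
  | empty => simp
  | insert i S hi ih =>
    rw [Finset.prod_insert hi, Finset.sum_insert hi, ih (fun j hj => hs j (Finset.mem_insert_of_mem hj)),
      ENNReal.rpow_add_of_nonneg _ _ (hs i (Finset.mem_insert_self _ _))
        (Finset.sum_nonneg fun j hj => hs j (Finset.mem_insert_of_mem hj))]

lemma J_bound (n : ℕ) {p mu al g : ℝ} (hp : 0 < p) (hs : 0 ≤ mu + 1/p)
    (F : (Fin (2*n+1) → ℝ) → ℝ≥0∞) (N : ℝ≥0∞)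
    (hN : ∀ a R, 0 < R → (∫⁻ x in hball n a R, wt n al x) ^ (-(mu + 1/p)) *
      (∫⁻ x in hball n a R, F x ^ p * wt n g x) ^ (1/p) ≤ N)
    (a : Fin (2*n+1) → ℝ) {R : ℝ} (hR : 0 < R) (hW : ∫⁻ x in hball n a R, wt n al x ≠ ⊤)
    {r : ℝ} (hr : 0 < r) :
    (∫⁻ x in hball n a R, F (hdil n r x) ^ p * wt n g x) ^ (1/p) ≤
      ENNReal.ofReal (r ^ (Qr n * mu - g/p + al * (mu + 1/p))) * (N *
        (∫⁻ x in hball n a R, wt n al x) ^ (mu + 1/p)) := by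
  have hkey : ∀ (s : ℝ) (H : (Fin (2*n+1) → ℝ) → ℝ≥0∞),
      ∫⁻ x in hball n a R, H (hdil n r x) * wt n s x =
      ENNReal.ofReal (r ^ (-s - Qr n)) * ∫⁻ x in hball n (hdil n r a) (r * R), H x * wt n s x := by
    intro s H
    have h := setLintegral_hdil n hr (fun x => H x * wt n s x) (hball n (hdil n r a) (r * R))
    rw [hball_preimage n hr] at h
    have hw : ∀ x, H (hdil n r x) * wt n s x =
        ENNReal.ofReal (r ^ (-s)) * (H (hdil n r x) * wt n s (hdil n r x)) := by
      intro x
      rw [wt_dil n s hr.le]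
      have : ENNReal.ofReal (r ^ (-s)) * ENNReal.ofReal (r ^ s) = 1 := by
        rw [← ENNReal.ofReal_mul (by positivity), ← Real.rpow_add hr]; simp
      calc H (hdil n r x) * wt n s x = (ENNReal.ofReal (r ^ (-s)) * ENNReal.ofReal (r ^ s)) * (H (hdil n r x) * wt n s x) := by
            rw [this, one_mul]
        _ = _ := by ring
    rw [lintegral_congr hw, lintegral_const_mul' _ _ ENNReal.ofReal_ne_top, h, ← mul_assoc,
      ← ENNReal.ofReal_mul (by positivity), ← Real.rpow_add hr, sub_eq_add_neg]
  set W := ∫⁻ x in hball n a R, wt n al x with hWd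
  set W' := ∫⁻ x in hball n (hdil n r a) (r * R), wt n al x with hW'd
  have hrR : 0 < r * R := mul_pos hr hR
  have hW'0 : W' ≠ 0 := (setLIntegral_wt_pos n al (hball_pos n _ hrR)).ne'
  have hWW : W = ENNReal.ofReal (r ^ (-al - Qr n)) * W' := by
    have := hkey al (fun _ => 1)
    simpa using this
  have hW'W : W' = ENNReal.ofReal (r ^ (al + Qr n)) * W := by
    rw [hWW, ← mul_assoc, ← ENNReal.ofReal_mul (by positivity), ← Real.rpow_add hr]
    simp
  have hW't : W' ≠ ⊤ := by
    rw [hW'W]; exact ENNReal.mul_ne_top ENNReal.ofReal_ne_top hW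
  have h1 := hN (hdil n r a) (r * R) hrR
  rw [hkey g (fun z => F z ^ p)]
  set I' := ∫⁻ x in hball n (hdil n r a) (r * R), F x ^ p * wt n g x
  have h2 : I' ^ (1/p) ≤ N * W' ^ (mu + 1/p) := by
    calc I' ^ (1/p) = (W' ^ (-(mu + 1/p)) * I' ^ (1/p)) * W' ^ (mu + 1/p) := by
          rw [mul_right_comm, ← ENNReal.rpow_add _ _ hW'0 hW't]; simp
      _ ≤ _ := mul_le_mul_left h1 _
  rw [ENNReal.mul_rpow_of_nonneg _ _ (by positivity)]
  refine (mul_le_mul_right h2 _).trans (le_of_eq ?_)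
  rw [hW'W, ENNReal.mul_rpow_of_nonneg _ _ hs, ENNReal.ofReal_rpow_of_pos (by positivity),
    ENNReal.ofReal_rpow_of_pos (by positivity), ← Real.rpow_mul hr.le, ← Real.rpow_mul hr.le]
  have : ENNReal.ofReal (r ^ (Qr n * mu - g/p + al * (mu + 1/p))) =
      ENNReal.ofReal (r ^ ((-g - Qr n) * (1/p))) * ENNReal.ofReal (r ^ ((al + Qr n) * (mu + 1/p))) := by
    rw [← ENNReal.ofReal_mul (by positivity), ← Real.rpow_add hr]
    congr 2; ring
  rw [this]; ring

lemma hlpOp_zero (n m : ℕ) (f : Fin m → (Fin (2*n+1) → ℝ) → ℝ)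
    (h : ¬ (AEMeasurable (fun y : Fin m → Fin (2*n+1) → ℝ => ∏ j, f j (y j)) ∧
      ¬ ∀ᵐ y : Fin m → Fin (2*n+1) → ℝ, ∏ j, f j (y j) = 0))
    {x : Fin (2*n+1) → ℝ} (hx : 0 < knorm n x) : hlpOp n m f x = 0 := by
  have hb : 0 < knorm n x ^ Qr n := Real.rpow_pos_of_pos hx _
  rw [not_and_or, not_not] at h
  have hop : hlpOp n m f x = ∫ y : Fin m → Fin (2*n+1) → ℝ,
    (∏ j, f j (y j)) / (Kmax n m (knorm n x ^ Qr n) y) ^ m := rfl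
  rw [hop]
  rcases h with h | h
  · refine integral_non_aestronglyMeasurable fun hcon => h ?_
    have h5 := hcon.aemeasurable.mul ((Kmax_meas n m (knorm n x ^ Qr n)).pow_const m).aemeasurable
    refine h5.congr (Filter.Eventually.of_forall fun y => ?_)
    simp only [Pi.mul_apply]
    exact div_mul_cancel₀ _ (pow_ne_zero _ (Kmax_pos n m hb y).ne')
  · refine integral_eq_zero_of_ae ?_
    filter_upwards [h] with y hy
    simp [hy]

lemma ofReal_absq (n : ℕ) {q : ℝ} (hq : 0 ≤ q) (ga t : ℝ) (x : Fin (2*n+1) → ℝ) :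
    ENNReal.ofReal (|t| ^ q * knorm n x ^ ga) = ENNReal.ofReal |t| ^ q * wt n ga x := by
  rw [ENNReal.ofReal_mul (by positivity), ENNReal.ofReal_rpow_of_nonneg (abs_nonneg _) hq]
  rfl

lemma upper (n m : ℕ) (hm : 1 ≤ m)
    (q lam al ga : ℝ) (qj lamj gaj : Fin m → ℝ)
    (hq : 1 ≤ q) (hlam1 : 0 < lam + 1/q)
    (hqj : ∀ j, 1 < qj j)
    (hsum : 1/q = ∑ j, 1/(qj j))
    (hga : ga = ∑ j, gaj j)
    (hlamj1 : ∀ j, 0 < lamj j + 1/(qj j))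
    (hlsum : ∑ j, (lamj j + 1/(qj j)) = lam + 1/q)
    (f : Fin m → (Fin (2*n+1) → ℝ) → ℝ)
    (hf : ∀ j x, 0 ≤ f j x)
    (hrad : ∀ j x y, knorm n x = knorm n y → f j x = f j y) :
    morreyNorm n q lam al ga (hlpOp n m f)
      ≤ Aconst n m (fun j => Qr n * lamj j - gaj j / q + al * (lamj j + 1/(qj j))) *
        ∏ j, morreyNorm n (qj j) (lamj j) al (qj j * gaj j / q) (f j) := by
  have hq0 : 0 < q := by linarith
  have hqj0 : ∀ j, 0 < qj j := fun j => by linarith [hqj j]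
  set e : Fin m → ℝ := fun j => Qr n * lamj j - gaj j / q + al * (lamj j + 1/(qj j)) with he
  set N : Fin m → ℝ≥0∞ := fun j => morreyNorm n (qj j) (lamj j) al (qj j * gaj j / q) (f j) with hNd
  refine iSup_le fun a => iSup_le fun R => iSup_le fun hR => ?_
  change (∫⁻ x in hball n a R, wt n al x) ^ (-(lam + 1/q)) * _ ≤ _
  set B := hball n a R with hB
  by_cases hWt : ∫⁻ x in B, wt n al x = ⊤
  · rw [hWt, ENNReal.top_rpow_of_neg (by linarith), zero_mul]; exact zero_le
  have hW0 : ∫⁻ x in B, wt n al x ≠ 0 := (setLIntegral_wt_pos n al (hball_pos n a hR)).ne'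
  by_cases hmeas : AEMeasurable (fun y : Fin m → Fin (2*n+1) → ℝ => ∏ j, f j (y j)) ∧
      ¬ ∀ᵐ y : Fin m → Fin (2*n+1) → ℝ, ∏ j, f j (y j) = 0
  swap
  · have : ∫⁻ x in B, ENNReal.ofReal (|hlpOp n m f x| ^ q * knorm n x ^ ga) = 0 := by
      rw [← lintegral_zero (μ := volume.restrict B)]
      refine lintegral_congr_ae (ae_restrict_of_ae ?_)
      filter_upwards [ae_knorm_pos n] with x hx
      rw [hlpOp_zero n m f hmeas hx]
      simp [Real.zero_rpow hq0.ne']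
    rw [this, ENNReal.zero_rpow_of_pos (by positivity), mul_zero]
    exact zero_le
  have hfm : ∀ j, AEMeasurable (f j) := by
    obtain ⟨k, rfl⟩ : ∃ k, m = k + 1 := ⟨m - 1, by omega⟩
    exact fun j => aemeas_of_prod k f hmeas.1 hmeas.2 j
  have hFm : ∀ j, AEMeasurable (fun x => ENNReal.ofReal (f j x)) := fun j => (hfm j).ennreal_ofReal
  have hNb : ∀ j, ∀ a R, 0 < R → (∫⁻ x in hball n a R, wt n al x) ^ (-(lamj j + 1/(qj j))) *
      (∫⁻ x in hball n a R, (ENNReal.ofReal (f j x)) ^ (qj j) * wt n (qj j * gaj j / q) x) ^ (1/(qj j)) ≤ N j := by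
    intro j a R hR
    have h1 : ∀ x, (ENNReal.ofReal (f j x)) ^ (qj j) * wt n (qj j * gaj j / q) x
        = ENNReal.ofReal (|f j x| ^ (qj j) * knorm n x ^ (qj j * gaj j / q)) := by
      intro x
      rw [ofReal_absq n (hqj0 j).le, abs_of_nonneg (hf j x)]
    simp only [h1]
    exact le_iSup_of_le a (le_iSup_of_le R (le_iSup_of_le hR le_rfl))
  set W := ∫⁻ x in B, wt n al x with hWd
  set D : ℝ≥0∞ := (∏ j, N j) * W ^ (lam + 1/q) with hD
  set c : (Fin m → Fin (2*n+1) → ℝ) → ℝ≥0∞ := fun y => (∏ j, wt n (e j) (y j)) * Ker n m 1 y with hc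
  set F : (Fin m → Fin (2*n+1) → ℝ) → (Fin (2*n+1) → ℝ) → ℝ≥0∞ := fun y x =>
    (∏ j, ENNReal.ofReal (f j (hdil n (knorm n (y j)) x))) * Ker n m 1 y * wt n (ga/q) x with hF
  have hKt : ∀ y, Ker n m 1 y ≠ ⊤ := fun y => ENNReal.ofReal_ne_top
  have hFmeas : AEMeasurable (Function.uncurry F)
      ((volume : Measure (Fin m → Fin (2*n+1) → ℝ)).prod (volume.restrict B)) := by
    refine AEMeasurable.mul (AEMeasurable.mul ?_ ?_) ?_
    · refine Finset.aemeasurable_fun_prod _ (fun j _ => ?_)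
      exact (hFm j).comp_quasiMeasurePreserving (qmp_joint n m B j)
    · exact ((Ker_meas n m 1).comp measurable_fst).aemeasurable
    · exact ((wt_meas n _).comp measurable_snd).aemeasurable
  have hcm : Measurable c := by
    refine Measurable.mul ?_ (Ker_meas n m 1)
    exact Finset.measurable_fun_prod _ (fun j _ => (wt_meas n _).comp (measurable_pi_apply j))
  have hc0 : ∀ᵐ y, c y ≠ 0 := by
    filter_upwards [ae_all_pos n m] with y hy
    refine mul_ne_zero (Finset.prod_ne_zero_iff.2 fun j _ => (wt_pos n _ (hy j)).ne') ?_
    refine (ENNReal.ofReal_pos.2 ?_).ne'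
    have := Kmax_pos n m one_pos y
    positivity
  have hct : ∀ y, c y ≠ ⊤ := fun y =>
    ENNReal.mul_ne_top (ENNReal.prod_ne_top fun j _ => wt_ne_top _ _ _) (hKt y)
  have hb : ∀ᵐ y, ∫⁻ x in B, F y x ^ q ≤ (c y * D) ^ q := by
    filter_upwards [ae_all_pos n m] with y hy
    have h1 : ∫⁻ x in B, F y x ^ q = Ker n m 1 y ^ q * ∫⁻ x in B, ∏ j,
        (ENNReal.ofReal (f j (hdil n (knorm n (y j)) x)) ^ (qj j) * wt n (qj j * gaj j / q) x) ^ (q / qj j) := by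
      rw [← lintegral_const_mul' _ _ (ENNReal.rpow_ne_top_of_nonneg hq0.le (hKt y))]
      refine lintegral_congr_ae (ae_restrict_of_ae ?_)
      filter_upwards [ae_knorm_pos n] with x hx
      have h2 : ∀ j, (ENNReal.ofReal (f j (hdil n (knorm n (y j)) x)) ^ (qj j) * wt n (qj j * gaj j / q) x) ^ (q / qj j)
          = ENNReal.ofReal (f j (hdil n (knorm n (y j)) x)) ^ q * wt n (gaj j) x := by
        intro j
        have := hqj0 j
        rw [ENNReal.mul_rpow_of_nonneg _ _ (by positivity), ← ENNReal.rpow_mul, wt_rpow n _ _ hx]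
        congr 2 <;> field_simp
      simp only [h2, hF, Finset.prod_mul_distrib, wt_prod n _ _ hx, ← hga]
      rw [ENNReal.mul_rpow_of_nonneg _ _ hq0.le, ENNReal.mul_rpow_of_nonneg _ _ hq0.le,
        wt_rpow n _ _ hx, div_mul_cancel₀ _ hq0.ne', ENNReal.prod_rpow_of_nonneg hq0.le]
      ring
    have h3 : ∫⁻ x in B, ∏ j,
        (ENNReal.ofReal (f j (hdil n (knorm n (y j)) x)) ^ (qj j) * wt n (qj j * gaj j / q) x) ^ (q / qj j)
        ≤ ∏ j, (∫⁻ x in B, ENNReal.ofReal (f j (hdil n (knorm n (y j)) x)) ^ (qj j) * wt n (qj j * gaj j / q) x) ^ (q / qj j) := by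
      refine ENNReal.lintegral_prod_norm_pow_le _ (fun j _ => ?_) ?_ (fun j _ => ?_)
      · refine AEMeasurable.mul (AEMeasurable.pow_const ?_ _) (wt_meas n _).aemeasurable
        exact ((hFm j).comp_quasiMeasurePreserving (qmp_hdil n (hy j))).restrict
      · have : ∀ j, q / qj j = q * (1 / qj j) := fun j => by ring
        simp only [this]
        rw [← Finset.mul_sum, ← hsum, mul_one_div_cancel hq0.ne']
      · have := hqj0 j; positivity
    have h4 : ∀ j, (∫⁻ x in B, ENNReal.ofReal (f j (hdil n (knorm n (y j)) x)) ^ (qj j) * wt n (qj j * gaj j / q) x) ^ (q / qj j)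
        ≤ (wt n (e j) (y j) * (N j * W ^ (lamj j + 1/(qj j)))) ^ q := by
      intro j
      have h5 := J_bound n (hqj0 j) (hlamj1 j).le (fun x => ENNReal.ofReal (f j x)) (N j) (hNb j) a hR hWt (hy j)
      rw [show q / qj j = (1 / qj j) * q by ring, ENNReal.rpow_mul]
      refine ENNReal.rpow_le_rpow (h5.trans (le_of_eq ?_)) hq0.le
      congr 1
      unfold wt
      congr 2
      simp only [he]
      have := hqj0 j
      field_simp
    rw [h1]
    refine (mul_le_mul_right (h3.trans (Finset.prod_le_prod' fun j _ => h4 j)) _).trans (le_of_eq ?_)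
    rw [ENNReal.prod_rpow_of_nonneg hq0.le, ← ENNReal.mul_rpow_of_nonneg _ _ hq0.le]
    congr 1
    rw [Finset.prod_mul_distrib, Finset.prod_mul_distrib, prod_rpow_const _ _ _ (fun j _ => (hlamj1 j).le),
      hlsum, hc, hD]
    ring
  have hmk := mink (volume.restrict B) volume hq F hFmeas c hcm hc0 hct D hb
  rw [← Aconst_eq n m e] at hmk
  have hle : ∫⁻ x in B, ENNReal.ofReal (|hlpOp n m f x| ^ q * knorm n x ^ ga)
      ≤ ∫⁻ x in B, (∫⁻ y, F y x) ^ q := by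
    refine lintegral_mono_ae (ae_restrict_of_ae ?_)
    filter_upwards [ae_knorm_pos n] with x hx
    rw [ofReal_absq n hq0.le]
    simp only [hF]
    rw [lintegral_mul_const' _ _ (wt_ne_top _ _ _), ENNReal.mul_rpow_of_nonneg _ _ hq0.le,
      wt_rpow n _ _ hx, div_mul_cancel₀ _ hq0.ne']
    refine mul_le_mul_left (ENNReal.rpow_le_rpow ?_ hq0.le) _
    refine (hlpOp_le n m f hf hx).trans (le_of_eq (lintegral_congr fun y => ?_))
    congr 1
    refine Finset.prod_congr rfl (fun j _ => ?_)
    congr 1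
    refine hrad j _ _ ?_
    rw [knorm_dil n hx.le, knorm_dil n (knorm_nonneg _ _), mul_comm]
  calc W ^ (-(lam + 1/q)) * (∫⁻ x in B, ENNReal.ofReal (|hlpOp n m f x| ^ q * knorm n x ^ ga)) ^ (1/q)
      ≤ W ^ (-(lam + 1/q)) * ((Aconst n m e * D) ^ q) ^ (1/q) := by
        refine mul_le_mul_right (ENNReal.rpow_le_rpow (hle.trans hmk) (by positivity)) _
    _ = (W ^ (-(lam + 1/q)) * W ^ (lam + 1/q)) * (Aconst n m e * ∏ j, N j) := by
        rw [← ENNReal.rpow_mul, mul_one_div_cancel hq0.ne', ENNReal.rpow_one, hD]; ring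
    _ = Aconst n m e * ∏ j, N j := by
        rw [← ENNReal.rpow_add _ _ hW0 hWt]; simp


theorem stmt2 (n : ℕ) (hn : 1 ≤ n) (m : ℕ) (hm : 1 ≤ m)
    (q lam al ga : ℝ) (qj lamj gaj : Fin m → ℝ)
    (hq : 1 ≤ q) (hlam1 : -(1/q) ≤ lam) (hlam2 : lam < 0)
    (hqj : ∀ j, 1 < qj j)
    (hsum : 1/q = ∑ j, 1/(qj j))
    (hga : ga = ∑ j, gaj j)
    (hal : al ≠ -(Qr n))
    (hlamj1 : ∀ j, -(1/(qj j)) < lamj j) (hlamj2 : ∀ j, lamj j < 0)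
    (hql : ∀ j, q * lam = qj j * lamj j)
    (hA : Aconst n m (fun j => Qr n * lamj j - gaj j / q + al * (lamj j + 1/(qj j))) < ⊤) :
    sInf {C : ℝ≥0∞ | ∀ f : Fin m → (Fin (2*n+1) → ℝ) → ℝ,
        (∀ j x, 0 ≤ f j x) →
        (∀ j x y, knorm n x = knorm n y → f j x = f j y) →
        (∀ j, morreyNorm n (qj j) (lamj j) al (qj j * gaj j / q) (f j) < ⊤) →
        morreyNorm n q lam al ga (hlpOp n m f)
          ≤ C * ∏ j, morreyNorm n (qj j) (lamj j) al (qj j * gaj j / q) (f j)}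
      = Aconst n m (fun j => Qr n * lamj j - gaj j / q + al * (lamj j + 1/(qj j)))
    ∧ morreyNorm n q lam al ga
        (hlpOp n m (fun j x => knorm n x ^ (Qr n * lamj j - gaj j / q + al * (lamj j + 1/(qj j)))))
      = Aconst n m (fun j => Qr n * lamj j - gaj j / q + al * (lamj j + 1/(qj j)))
        * ∏ j, morreyNorm n (qj j) (lamj j) al (qj j * gaj j / q)
            (fun x => knorm n x ^ (Qr n * lamj j - gaj j / q + al * (lamj j + 1/(qj j)))) := by
  have hq0 : 0 < q := by linarith
  have hqj0 : ∀ j, 0 < qj j := fun j => by linarith [hqj j]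
  have hQ := Qr_pos n
  have hlamj3 : ∀ j, 0 < lamj j + 1/(qj j) := fun j => by linarith [hlamj1 j]
  have hlj : ∀ j, lamj j = q * lam * (1/(qj j)) := fun j => by
    have := hqj0 j
    rw [hql j]; field_simp
  have hsl : ∑ j, lamj j = lam := by
    rw [Finset.sum_congr rfl (fun j _ => hlj j), ← Finset.mul_sum, ← hsum]
    field_simp
  have hlsum : ∑ j, (lamj j + 1/(qj j)) = lam + 1/q := by
    rw [Finset.sum_add_distrib, hsl, ← hsum]
  set κ : ℝ := q * lam + 1 with hκ
  have hκj : ∀ j, lamj j + 1/(qj j) = κ / qj j := fun j => by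
    rw [hlj j, hκ]; ring
  have hκ0 : 0 < κ := by
    have h1 := hlamj3 ⟨0, hm⟩
    rw [hκj, div_pos_iff_of_pos_right (hqj0 _)] at h1
    exact h1
  have hκ1 : κ ≤ 1 := by
    rw [hκ]; nlinarith
  have hκq : lam + 1/q = κ / q := by rw [hκ]; field_simp
  have hlq : 0 < lam + 1/q := by rw [hκq]; positivity
  set e : Fin m → ℝ := fun j => Qr n * lamj j - gaj j / q + al * (lamj j + 1/(qj j)) with he
  set A := Aconst n m e with hAd
  have hesum : ∑ j, e j = Qr n * lam - ga / q + al * (lam + 1/q) := by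
    simp only [he]
    rw [Finset.sum_add_distrib, Finset.sum_sub_distrib, ← Finset.mul_sum, ← Finset.mul_sum,
      ← Finset.sum_div, hsl, hlsum, hga]
  have hnormj : ∀ j, morreyNorm n (qj j) (lamj j) al (qj j * gaj j / q) (fun x => knorm n x ^ e j)
      = Msup n al κ ^ (1 / qj j) := by
    intro j
    have hj := hqj0 j
    rw [morrey_eq n (c := 1) hj (hκj j) ENNReal.one_ne_top, one_mul]
    filter_upwards [ae_knorm_pos n] with x hx
    rw [ENNReal.one_rpow, one_mul, abs_of_nonneg (Real.rpow_nonneg hx.le _), ← Real.rpow_mul hx.le,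
      ← Real.rpow_add hx]
    unfold wt
    congr 2
    simp only [he, hκ]
    rw [hql j]
    field_simp
    ring
  have hnorm : morreyNorm n q lam al ga (hlpOp n m (fun j x => knorm n x ^ e j))
      = A * Msup n al κ ^ (1 / q) := by
    refine morrey_eq n hq0 hκq hA.ne ?_
    filter_upwards [ae_knorm_pos n] with x hx
    rw [ofReal_absq n hq0.le, hlpOp_pow n m e hA hx, ENNReal.mul_rpow_of_nonneg _ _ hq0.le,
      wt_rpow n _ _ hx, mul_assoc, wt_mul n _ _ hx, hesum]
    congr 2
    rw [hκ]
    field_simp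
    ring
  have hprod : ∏ j, morreyNorm n (qj j) (lamj j) al (qj j * gaj j / q) (fun x => knorm n x ^ e j)
      = Msup n al κ ^ (1 / q) := by
    rw [Finset.prod_congr rfl (fun j _ => hnormj j), prod_rpow_const _ _ _ (fun j _ => ?_), ← hsum]
    have := hqj0 j; positivity
  have hM0 := Msup_pos n hn hal hκ0
  have hMt := Msup_lt_top n hal hκ0 hκ1
  refine ⟨le_antisymm ?_ ?_, ?_⟩
  · refine sInf_le ?_
    intro f hf hrad _
    exact upper n m hm q lam al ga qj lamj gaj hq hlq hqj hsum hga hlamj3 hlsum f hf hrad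
  · refine le_sInf ?_
    intro C hC
    have h := hC (fun j x => knorm n x ^ e j) (fun j x => Real.rpow_nonneg (knorm_nonneg _ _) _)
      (fun j x y hxy => by simp only [hxy])
      (fun j => by
        rw [hnormj j]
        exact ENNReal.rpow_lt_top_of_nonneg (by have := hqj0 j; positivity) hMt.ne)
    rw [hnorm, hprod] at h
    refine (ENNReal.mul_le_mul_iff_left ?_ ?_).1 h
    · exact (ENNReal.rpow_pos hM0 hMt.ne).ne'
    · exact ENNReal.rpow_ne_top_of_nonneg (by positivity) hMt.ne
  · rw [hnorm, hprod]
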